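/- For every integer n ≥ 17, every n-vertex P̂₄-free graph with at least ⌊n²/8⌋ triangles contains no K₄ as a subgraph. -/

import Mathlib

/-- `H` is contained in `G` as a (not necessarily induced) subgraph:
there is an injective map of vertices carrying edges of `H` to edges of `G`. -/
def Contains {α β : Type*} (H : SimpleGraph α) (G : SimpleGraph β) : Prop :=
  ∃ f : α → β, Function.Injective f ∧ ∀ ⦃a b⦄, H.Adj a b → G.Adj (f a) (f b)

/-- The suspension `P̂₄` of the path on 4 vertices: a new apex vertex `none`
is joined to all four vertices of `P₄`. -/
def hatP4 : SimpleGraph (Option (Fin 4)) :=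
  SimpleGraph.fromRel (fun a b =>
    (∃ i j, a = some i ∧ b = some j ∧ (SimpleGraph.pathGraph 4).Adj i j) ∨ a = none)

/-- The number of triangles (3-cliques) of a graph. -/
noncomputable def triangleCount {V : Type*} (G : SimpleGraph V) : ℕ :=
  (G.cliqueSet 3).ncard

open Finset

/-- Pointwise form of `P̂₄`-freeness: no vertex has a path on four vertices in its neighbourhood. -/
def PathSuspensionFree {V : Type*} (G : SimpleGraph V) : Prop :=
  ∀ x a b c d, G.Adj x a → G.Adj x b → G.Adj x c → G.Adj x d →
    G.Adj a b → G.Adj b c → G.Adj c d → a ≠ c → a ≠ d → b ≠ d → False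

theorem pathSuspensionFree_of_not_contains {V : Type*} {G : SimpleGraph V}
    (h : ¬ Contains hatP4 G) : PathSuspensionFree G := by
  intro x a b c d xa xb xc xd ab bc cd hac had hbd
  apply h
  have hab := ab.ne
  have hbc := bc.ne
  have hcd := cd.ne
  have hxa := xa.ne
  have hxb := xb.ne
  have hxc := xc.ne
  have hxd := xd.ne
  refine ⟨fun o => o.elim x ![a, b, c, d], ?_, ?_⟩
  · intro p q hpq
    rcases p with _ | p <;> rcases q with _ | q
    · rfl
    · fin_cases q <;> simp_all
    · fin_cases p <;> simp_all
    · fin_cases p <;> fin_cases q <;> simp_all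
  · intro p q hpq
    rcases p with _ | p <;> rcases q with _ | q
    · simp [hatP4] at hpq
    · fin_cases q <;> simp_all
    · fin_cases p <;> simp_all [G.adj_comm]
    · fin_cases p <;> fin_cases q <;>
        simp_all [hatP4, SimpleGraph.pathGraph_adj, G.adj_comm]

section Structure

set_option linter.unusedSectionVars false

variable {V : Type*} [Fintype V] [DecidableEq V] {G : SimpleGraph V} [DecidableRel G.Adj]

theorem PathSuspensionFree.eq_of_adj_of_adj (h : PathSuspensionFree G) {K : Finset V}
    (hK : G.IsNClique 4 K) {u a b : V} (hu : u ∉ K) (ha : a ∈ K) (hb : b ∈ K)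
    (hua : G.Adj u a) (hub : G.Adj u b) : a = b := by
  by_contra hab
  have hcard : ((K.erase a).erase b).card = 2 := by
    rw [card_erase_of_mem (by simp [hb, Ne.symm hab]), card_erase_of_mem ha, hK.card_eq]
  obtain ⟨c, d, hcd, hs⟩ := card_eq_two.mp hcard
  have hc : c ∈ (K.erase a).erase b := by simp [hs]
  have hd : d ∈ (K.erase a).erase b := by simp [hs]
  simp only [mem_erase] at hc hd
  have hcl := hK.isClique
  refine h a u b c d hua.symm (hcl ha hb hab) (hcl ha hc.2.2 (Ne.symm hc.2.1))
    (hcl ha hd.2.2 (Ne.symm hd.2.1)) hub (hcl hb hc.2.2 (Ne.symm hc.1)) (hcl hc.2.2 hd.2.2 hcd)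
    ?_ ?_ (Ne.symm hd.1)
  · rintro rfl; exact hu hc.2.2
  · rintro rfl; exact hu hd.2.2

theorem PathSuspensionFree.eq_of_two_mem (h : PathSuspensionFree G) {K L : Finset V}
    (hK : G.IsNClique 4 K) (hL : G.IsNClique 4 L) {a b : V} (hab : a ≠ b)
    (haK : a ∈ K) (hbK : b ∈ K) (haL : a ∈ L) (hbL : b ∈ L) : K = L := by
  refine (eq_of_subset_of_card_le (fun u hu => ?_) (by rw [hK.card_eq, hL.card_eq])).symm
  by_contra huK
  exact hab (h.eq_of_adj_of_adj hK huK haK hbK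
    (hL.isClique hu haL (by rintro rfl; exact huK haK))
    (hL.isClique hu hbL (by rintro rfl; exact huK hbK)))

theorem PathSuspensionFree.subset_of_two_mem (h : PathSuspensionFree G) {K T : Finset V}
    (hK : G.IsNClique 4 K) (hT : G.IsClique (T : Set V)) {a b : V} (hab : a ≠ b)
    (haK : a ∈ K) (hbK : b ∈ K) (haT : a ∈ T) (hbT : b ∈ T) : T ⊆ K := by
  intro u hu
  by_contra huK
  exact hab (h.eq_of_adj_of_adj hK huK haK hbK
    (hT hu haT (by rintro rfl; exact huK haK))
    (hT hu hbT (by rintro rfl; exact huK hbK)))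

variable (G) in
/-- The triangles that lie in no `K₄`. -/
def bookTriangles : Finset (Finset V) :=
  {T ∈ G.cliqueFinset 3 | ∀ K ∈ G.cliqueFinset 4, ¬ T ⊆ K}

/-- `z` is an apex of `T`: every edge of `T` at `z` lies in no triangle besides `T`. -/
def IsApex (G : SimpleGraph V) (T : Finset V) (z : V) : Prop :=
  z ∈ T ∧ ∀ y ∈ T, y ≠ z → ∀ w, G.Adj w z → G.Adj w y → w ∈ T

theorem PathSuspensionFree.exists_isApex (h : PathSuspensionFree G) {T : Finset V}
    (hT : T ∈ bookTriangles G) : ∃ z, IsApex G T z := by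
  simp only [bookTriangles, mem_filter, SimpleGraph.mem_cliqueFinset_iff] at hT
  obtain ⟨hT3, hTK⟩ := hT
  obtain ⟨x, y, z, xy, xz, yz, rfl⟩ := SimpleGraph.is3Clique_iff.mp hT3
  have key : ∀ p q r, ({p, q, r} : Finset V) = {x, y, z} → G.Adj p q → G.Adj p r → G.Adj q r →
      ∀ w w', w ∉ ({p, q, r} : Finset V) → w' ∉ ({p, q, r} : Finset V) →
        G.Adj w p → G.Adj w q → G.Adj w' p → G.Adj w' r → False := by
    intro p q r he pq pr qr w w' hw hw' wp wq wp' wr'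
    simp only [mem_insert, mem_singleton, not_or] at hw hw'
    by_cases hww : w = w'
    · subst hww
      refine hTK {w, p, q, r} ?_ ?_
      · have h3 : G.IsNClique 3 {p, q, r} := SimpleGraph.is3Clique_triple_iff.mpr ⟨pq, pr, qr⟩
        refine h3.insert ?_
        intro b hb
        simp only [mem_insert, mem_singleton] at hb
        rcases hb with rfl | rfl | rfl <;> assumption
      · rw [← he]; exact subset_insert _ _
    · exact h p w q r w' wp.symm pq pr wp'.symm wq qr wr'.symm hw.2.2 hww (Ne.symm hw'.2.1)
  by_contra hno
  simp only [IsApex, not_exists, not_and, not_forall] at hno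
  obtain ⟨a, ha, hax, u, hux, hua, hu⟩ := hno x (by simp)
  obtain ⟨b, hb, hby, v, hvy, hvb, hv⟩ := hno y (by simp)
  obtain ⟨c, hc, hcz, w, hwz, hwc, hw⟩ := hno z (by simp)
  have e1 : ({x, z, y} : Finset V) = {x, y, z} := by ext; simp; tauto
  have e2 : ({y, x, z} : Finset V) = {x, y, z} := by ext; simp; tauto
  have e3 : ({z, x, y} : Finset V) = {x, y, z} := by ext; simp; tauto
  have kx := key x y z rfl xy xz yz
  have ky := key y x z e2 xy.symm yz xz
  have kz := key z x y e3 xz.symm yz.symm xy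
  rw [e2] at ky
  rw [e3] at kz
  simp only [mem_insert, mem_singleton] at ha hb hc
  rcases ha with rfl | rfl | rfl
  · exact hax rfl
  · rcases hc with rfl | rfl | rfl
    · exact kx u w hu hw hux hua hwc hwz
    · exact ky u w hu hw hua hux hwc hwz
    · exact hcz rfl
  · rcases hb with rfl | rfl | rfl
    · exact kx v u hv hu hvb hvy hux hua
    · exact hby rfl
    · exact kz u v hu hv hua hux hvb hvy

/-- The neighbours of `v` along the edges of `T` that contain the vertex `z`. -/
def apexLink (T : Finset V) (z v : V) : Finset V :=
  if v = z then T.erase v else {z}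

variable (G) in
/-- The neighbours of `v` along apex edges of book triangles and along edges of `K₄`s. -/
def blockNeighbors (apex : Finset V → V) (v : V) : Finset V :=
  ({T ∈ bookTriangles G | v ∈ T}.biUnion fun T => apexLink T (apex T) v) ∪
    {K ∈ G.cliqueFinset 4 | v ∈ K}.biUnion fun K => K.erase v

variable (G) in
/-- The number of apex edges of book triangles at `v`. -/
def apexDegree (apex : Finset V → V) (v : V) : ℕ :=
  ∑ T ∈ bookTriangles G with v ∈ T, if v = apex T then 2 else 1

variable (G) in
/-- The number of copies of `K₄` through `v`. -/
def quadDegree (v : V) : ℕ := #{K ∈ G.cliqueFinset 4 | v ∈ K}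

theorem IsApex.mem_of_mem_apexLink {T : Finset V} {z u v : V} (hz : IsApex G T z) (hv : v ∈ T)
    (hu : u ∈ apexLink T z v) :
    u ∈ T ∧ u ≠ v ∧ ∀ w, G.Adj w u → G.Adj w v → w ∈ T := by
  unfold apexLink at hu
  split_ifs at hu with hvz
  · subst hvz
    rw [mem_erase] at hu
    exact ⟨hu.2, hu.1, fun w h1 h2 => hz.2 u hu.2 hu.1 w h2 h1⟩
  · rw [mem_singleton] at hu
    subst hu
    exact ⟨hz.1, Ne.symm hvz, fun w h1 h2 => hz.2 v hv hvz w h1 h2⟩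

theorem mem_bookTriangles {T : Finset V} : T ∈ bookTriangles G ↔
    G.IsNClique 3 T ∧ ∀ K, G.IsNClique 4 K → ¬ T ⊆ K := by
  simp [bookTriangles]

theorem IsApex.eq_of_mem_apexLink {T T' : Finset V} {z u v : V} (hz : IsApex G T z)
    (hT : G.IsNClique 3 T) (hT' : G.IsNClique 3 T')
    (hv : v ∈ T) (hu : u ∈ apexLink T z v) (hv' : v ∈ T') (hu' : u ∈ T') : T' = T := by
  obtain ⟨huT, huv, hw⟩ := hz.mem_of_mem_apexLink hv hu
  refine eq_of_subset_of_card_le (fun w hwT => ?_) (by rw [hT.card_eq, hT'.card_eq])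
  by_cases h1 : w = u
  · rwa [h1]
  by_cases h2 : w = v
  · rwa [h2]
  exact hw w (hT'.isClique hwT hu' h1) (hT'.isClique hwT hv' h2)

theorem adj_of_mem_blockNeighbors {apex : Finset V → V}
    (hapex : ∀ T ∈ bookTriangles G, IsApex G T (apex T)) {u v : V}
    (hu : u ∈ blockNeighbors G apex v) : G.Adj u v := by
  simp only [blockNeighbors, mem_union, mem_biUnion, mem_filter,
    SimpleGraph.mem_cliqueFinset_iff, mem_erase] at hu
  rcases hu with ⟨T, ⟨hT, hv⟩, hu⟩ | ⟨K, ⟨hK, hv⟩, huv, hu⟩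
  · obtain ⟨huT, huv, -⟩ := (hapex T hT).mem_of_mem_apexLink hv hu
    exact (mem_bookTriangles.mp hT).1.isClique huT hv huv
  · exact hK.isClique hu hv huv

theorem PathSuspensionFree.apexDegree_add_quadDegree_le (h : PathSuspensionFree G)
    {apex : Finset V → V} (hapex : ∀ T ∈ bookTriangles G, IsApex G T (apex T)) (v : V) :
    apexDegree G apex v + 3 * quadDegree G v ≤ #(blockNeighbors G apex v) := by
  have hdisj : Disjoint
      ({T ∈ bookTriangles G | v ∈ T}.biUnion fun T => apexLink T (apex T) v)
      ({K ∈ G.cliqueFinset 4 | v ∈ K}.biUnion fun K => K.erase v) := by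
    rw [Finset.disjoint_left]
    intro u hu hu'
    simp only [mem_biUnion, mem_filter, SimpleGraph.mem_cliqueFinset_iff, mem_erase] at hu hu'
    obtain ⟨T, ⟨hT, hv⟩, hu⟩ := hu
    obtain ⟨K, ⟨hK, hvK⟩, huv, huK⟩ := hu'
    have hT' := mem_bookTriangles.mp hT
    have := (hapex T hT).mem_of_mem_apexLink hv hu
    exact hT'.2 K hK (h.subset_of_two_mem hK hT'.1.isClique huv huK hvK this.1 hv)
  rw [blockNeighbors, card_union_of_disjoint hdisj, card_biUnion, card_biUnion]
  · refine le_of_eq (congrArg₂ _ (sum_congr rfl fun T hT => ?_) ?_)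
    · rw [mem_filter] at hT
      unfold apexLink
      split_ifs
      · rw [card_erase_of_mem hT.2, (mem_bookTriangles.mp hT.1).1.card_eq]
      · simp
    · rw [sum_congr rfl (g := fun _ => 3), sum_const, smul_eq_mul, mul_comm, quadDegree]
      intro K hK
      simp only [mem_filter, SimpleGraph.mem_cliqueFinset_iff] at hK
      rw [card_erase_of_mem hK.2, hK.1.card_eq]
  · intro K hK L hL hKL
    simp only [coe_filter, Set.mem_ofPred_eq,
      SimpleGraph.mem_cliqueFinset_iff] at hK hL
    rw [Function.onFun, Finset.disjoint_left]
    intro u hu hu'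
    rw [mem_erase] at hu hu'
    exact hKL (h.eq_of_two_mem hK.1 hL.1 hu.1 hu.2 hK.2 hu'.2 hL.2)
  · intro S hS T hT hST
    simp only [coe_filter, Set.mem_ofPred_eq] at hS hT
    rw [Function.onFun, Finset.disjoint_left]
    intro u hu hu'
    have hS' := (mem_bookTriangles.mp hS.1).1
    have hT' := (mem_bookTriangles.mp hT.1).1
    exact hST ((hapex T hT.1).eq_of_mem_apexLink hT' hS' hT.2 hu' hS.2
      ((hapex S hS.1).mem_of_mem_apexLink hS.2 hu).1)

theorem PathSuspensionFree.card_blockNeighbors_apex_add_le (h : PathSuspensionFree G)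
    {apex : Finset V → V} (hapex : ∀ T ∈ bookTriangles G, IsApex G T (apex T))
    {T : Finset V} (hT : T ∈ bookTriangles G) {x : V} (hx : x ∈ T) (hxz : x ≠ apex T) :
    #(blockNeighbors G apex (apex T)) + #(blockNeighbors G apex x) ≤ Fintype.card V := by
  have hT' := mem_bookTriangles.mp hT
  rw [← card_union_of_disjoint, ← card_univ]
  · exact card_le_card (subset_univ _)
  rw [Finset.disjoint_left]
  intro u huz hux
  have huz' := adj_of_mem_blockNeighbors hapex huz
  have hux' := adj_of_mem_blockNeighbors hapex hux
  have huT := (hapex T hT).2 x hx hxz u huz' hux'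
  simp only [blockNeighbors, mem_union, mem_biUnion, mem_filter,
    SimpleGraph.mem_cliqueFinset_iff, mem_erase] at hux
  rcases hux with ⟨S, ⟨hS, hxS⟩, hu⟩ | ⟨K, ⟨hK, hv⟩, huv, hu⟩
  · have hST := (hapex S hS).eq_of_mem_apexLink (mem_bookTriangles.mp hS).1 hT'.1 hxS hu hx huT
    subst hST
    rw [apexLink, if_neg hxz, mem_singleton] at hu
    exact huz'.ne hu
  · exact hT'.2 K hK (h.subset_of_two_mem hK hT'.1.isClique huv hu hv huT hx)

theorem PathSuspensionFree.sum_card_blockNeighbors_le (h : PathSuspensionFree G)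
    {apex : Finset V → V} (hapex : ∀ T ∈ bookTriangles G, IsApex G T (apex T))
    {K : Finset V} (hK : G.IsNClique 4 K) :
    ∑ v ∈ K, #(blockNeighbors G apex v) ≤ Fintype.card V + 8 := by
  calc ∑ v ∈ K, #(blockNeighbors G apex v)
      ≤ ∑ v ∈ K, #{u | G.Adj u v} := sum_le_sum fun v _ => card_le_card fun u hu => by
        simpa using adj_of_mem_blockNeighbors hapex hu
    _ = ∑ u, #{v ∈ K | G.Adj u v} := by
        simp only [card_filter]
        exact sum_comm
    _ ≤ ∑ u, (1 + if u ∈ K then 2 else 0) := sum_le_sum fun u _ => by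
        split_ifs with hu
        · have : #(K.erase u) = 3 := by rw [card_erase_of_mem hu, hK.card_eq]
          refine le_trans ?_ this.le
          refine card_le_card fun v hv => ?_
          rw [mem_filter] at hv
          exact mem_erase.mpr ⟨hv.2.ne', hv.1⟩
        · refine card_le_one.mpr fun a ha b hb => ?_
          rw [mem_filter] at ha hb
          exact h.eq_of_adj_of_adj hK hu ha.1 hb.1 ha.2 hb.2
    _ = Fintype.card V + 8 := by
        rw [sum_add_distrib, sum_ite_mem, univ_inter, sum_const, sum_const, hK.card_eq, card_univ]
        simp

theorem card_cliqueFinset_three_le :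
    #(G.cliqueFinset 3) ≤ #(bookTriangles G) + 4 * #(G.cliqueFinset 4) := by
  have hsub : G.cliqueFinset 3 ⊆
      bookTriangles G ∪ (G.cliqueFinset 4).biUnion fun K => K.powersetCard 3 := by
    intro T hT
    by_cases hTK : ∀ K ∈ G.cliqueFinset 4, ¬ T ⊆ K
    · exact mem_union_left _ (mem_filter.mpr ⟨hT, hTK⟩)
    · push Not at hTK
      obtain ⟨K, hK, hTK⟩ := hTK
      rw [SimpleGraph.mem_cliqueFinset_iff] at hT
      exact mem_union_right _ (mem_biUnion.mpr ⟨K, hK, mem_powersetCard.mpr ⟨hTK, hT.card_eq⟩⟩)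
  refine (card_le_card hsub).trans ((card_union_le _ _).trans (Nat.add_le_add_left ?_ _))
  rw [mul_comm]
  refine card_biUnion_le_card_mul _ _ _ fun K hK => ?_
  rw [SimpleGraph.mem_cliqueFinset_iff] at hK
  rw [card_powersetCard, hK.card_eq]
  rfl

theorem sum_apexDegree_mul (apex : Finset V → V)
    (hapex : ∀ T ∈ bookTriangles G, IsApex G T (apex T)) (f : V → ℕ) :
    ∑ v, apexDegree G apex v * f v =
      ∑ T ∈ bookTriangles G, ∑ x ∈ T.erase (apex T), (f (apex T) + f x) := by
  have : ∀ v, apexDegree G apex v * f v = ∑ T ∈ bookTriangles G,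
      if v ∈ T then (if v = apex T then 2 else 1) * f v else 0 := by
    intro v
    rw [apexDegree, sum_mul, sum_filter]
  simp only [this]
  rw [sum_comm]
  refine sum_congr rfl fun T hT => ?_
  rw [sum_ite_mem, univ_inter, ← add_sum_erase _ _ (hapex T hT).1, sum_add_distrib, sum_const,
    card_erase_of_mem (hapex T hT).1, (mem_bookTriangles.mp hT).1.card_eq, if_pos rfl]
  congr 1
  exact sum_congr rfl fun x hx => by rw [if_neg (ne_of_mem_erase hx), one_mul]

theorem sum_quadDegree_mul (f : V → ℕ) :
    ∑ v, quadDegree G v * f v = ∑ K ∈ G.cliqueFinset 4, ∑ v ∈ K, f v := by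
  have : ∀ v, quadDegree G v * f v =
      ∑ K ∈ G.cliqueFinset 4, if v ∈ K then f v else 0 := by
    intro v
    rw [quadDegree, card_filter, sum_mul]
    exact sum_congr rfl fun K _ => by split_ifs <;> simp
  simp only [this]
  rw [sum_comm]
  exact sum_congr rfl fun K _ => by rw [sum_ite_mem, univ_inter]

theorem sum_apexDegree (apex : Finset V → V)
    (hapex : ∀ T ∈ bookTriangles G, IsApex G T (apex T)) :
    ∑ v, apexDegree G apex v = 4 * #(bookTriangles G) := by
  have := sum_apexDegree_mul apex hapex fun _ => 1
  simp only [mul_one] at this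
  rw [this, sum_congr rfl (g := fun _ => 4), sum_const, smul_eq_mul, mul_comm]
  intro T hT
  rw [sum_const, card_erase_of_mem (hapex T hT).1, (mem_bookTriangles.mp hT).1.card_eq]
  rfl

theorem sum_quadDegree : ∑ v, quadDegree G v = 4 * #(G.cliqueFinset 4) := by
  have := sum_quadDegree_mul (G := G) fun _ => 1
  simp only [mul_one] at this
  rw [this, sum_congr rfl (g := fun _ => 4), sum_const, smul_eq_mul, mul_comm]
  intro K hK
  rw [SimpleGraph.mem_cliqueFinset_iff] at hK
  simp [hK.card_eq]

/-- The local excess of a vertex with `b` apex edges and `k` copies of `K₄` in a graph of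
order `n`. -/
def excess (n b k : ℤ) : ℤ :=
  4 * ((9 * b + 48 * k) * (b + 3 * k)) - 36 * n * b - (120 * n + 384) * k + 9 * n ^ 2

theorem PathSuspensionFree.sum_excess_le (h : PathSuspensionFree G) {apex : Finset V → V}
    (hapex : ∀ T ∈ bookTriangles G, IsApex G T (apex T)) {n : ℕ} (hn : Fintype.card V = n) :
    ∑ v, excess n (apexDegree G apex v) (quadDegree G v) ≤
      9 * n * (n ^ 2 - 8 * #(G.cliqueFinset 3)) := by
  set d : V → ℕ := fun v => #(blockNeighbors G apex v)
  have hB : ∑ v, apexDegree G apex v * d v ≤ #(bookTriangles G) * (2 * n) := by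
    rw [sum_apexDegree_mul apex hapex]
    refine sum_le_card_nsmul _ _ _ fun T hT => ?_
    refine (sum_le_card_nsmul _ _ n fun x hx => ?_).trans_eq ?_
    · rw [← hn]
      exact h.card_blockNeighbors_apex_add_le hapex hT (mem_of_mem_erase hx) (ne_of_mem_erase hx)
    · rw [card_erase_of_mem (hapex T hT).1, (mem_bookTriangles.mp hT).1.card_eq]
      rfl
  have hQ : ∑ v, quadDegree G v * d v ≤ #(G.cliqueFinset 4) * (n + 8) := by
    rw [sum_quadDegree_mul]
    refine sum_le_card_nsmul _ _ _ fun K hK => ?_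
    rw [← hn]
    exact h.sum_card_blockNeighbors_le hapex (by simpa using hK)
  have hB1 := sum_apexDegree apex hapex
  have hQ1 := sum_quadDegree (G := G)
  have ht := card_cliqueFinset_three_le (G := G)
  zify at hB hQ hB1 hQ1 ht
  have hpt : ∀ v, excess n (apexDegree G apex v) (quadDegree G v) ≤
      36 * ((apexDegree G apex v : ℤ) * d v) + 192 * ((quadDegree G v : ℤ) * d v)
        - 36 * n * apexDegree G apex v - (120 * n + 384) * quadDegree G v + 9 * (n : ℤ) ^ 2 := by
    intro v
    have h1 : (apexDegree G apex v : ℤ) + 3 * quadDegree G v ≤ d v := by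
      exact_mod_cast h.apexDegree_add_quadDegree_le hapex v
    have h2 : (0 : ℤ) ≤ 9 * apexDegree G apex v + 48 * quadDegree G v := by positivity
    have := mul_le_mul_of_nonneg_left h1 h2
    unfold excess
    linarith
  refine (sum_le_sum fun v _ => hpt v).trans ?_
  rw [sum_add_distrib, sum_sub_distrib, sum_sub_distrib, sum_add_distrib, ← mul_sum, ← mul_sum,
    ← mul_sum, ← mul_sum, hB1, hQ1, sum_const, card_univ, hn, nsmul_eq_mul]
  have := mul_le_mul_of_nonneg_left ht (Int.natCast_nonneg n)
  nlinarith

end Structure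

section Arithmetic

theorem nine_mul_excess (n b k : ℤ) : 9 * excess n b k =
    (9 * n - 18 * b - 60 * k) ^ 2 - k * (3456 - 540 * b - 1584 * k) := by
  unfold excess; ring

theorem le_nine_mul_excess {n b k : ℤ} (hb : 0 ≤ b) (hk : 1 ≤ k) :
    270 * n - 3897 ≤ 9 * excess n b k ∨ 540 * n - 8676 ≤ 9 * excess n b k ∨
      180 * n - 100 ≤ 9 * excess n b k := by
  rw [nine_mul_excess]
  obtain rfl | rfl | hk3 : k = 1 ∨ k = 2 ∨ 3 ≤ k := by omega
  · left
    nlinarith [sq_nonneg (9 * n - 75 - 18 * b)]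
  · right; left
    nlinarith [sq_nonneg (9 * n - 150 - 18 * b)]
  · right; right
    nlinarith [sq_nonneg (9 * n - 18 * b - 60 * k - 10), mul_nonneg hb (sub_nonneg.mpr hk3),
      mul_nonneg (sub_nonneg.mpr hk3) (sub_nonneg.mpr hk3)]

theorem excess_nonneg {n b k : ℤ} (hn : 17 ≤ n) (hb : 0 ≤ b) (hk : 0 ≤ k) :
    0 ≤ excess n b k := by
  obtain rfl | hk1 : k = 0 ∨ 1 ≤ k := by omega
  · have := nine_mul_excess n b 0
    nlinarith [sq_nonneg (9 * n - 18 * b)]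
  · have := le_nine_mul_excess (n := n) hb hk1
    omega

/-- A quantity `9 * n * (n ^ 2 - 8 * t)` with `n ^ 2 / 8 ≤ t` is small. -/
theorem nine_mul_mul_sub_le {n t : ℕ} (ht : n ^ 2 / 8 ≤ t) :
    (9 * n * (n ^ 2 - 8 * t) : ℤ) ≤ 36 * n ∧
      (n = 17 → (9 * n * (n ^ 2 - 8 * t) : ℤ) ≤ 153) := by
  have hmod : n ^ 2 % 8 ≤ 4 := by
    rw [Nat.pow_mod]
    have : n % 8 < 8 := Nat.mod_lt _ (by norm_num)
    interval_cases n % 8 <;> norm_num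
  have hle : ((n ^ 2 : ℕ) : ℤ) - 8 * t ≤ 4 := by omega
  push_cast at hle
  refine ⟨by nlinarith [Int.natCast_nonneg n], ?_⟩
  rintro rfl
  norm_num at ht ⊢
  omega

theorem excess_sum_four {n : ℤ} (hn : 17 ≤ n) {V : Type*} {K : Finset V} (hK : #K = 4)
    {b : V → ℤ} (hb : ∑ v ∈ K, b v ≤ n - 4) :
    36 * n < ∑ v ∈ K, excess n (b v) 1 ∨ n = 17 ∧ 153 < ∑ v ∈ K, excess n (b v) 1 := by
  have hcs : (∑ v ∈ K, (2 * b v)) ^ 2 ≤ 4 * ∑ v ∈ K, (2 * b v) ^ 2 := by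
    have := sq_sum_le_card_mul_sum_sq (s := K) (f := fun v => 2 * b v)
    rwa [hK] at this
  have hsum : ∑ v ∈ K, excess n (b v) 1 = 9 * ∑ v ∈ K, (2 * b v) ^ 2
      - (36 * n - 300) * ∑ v ∈ K, b v + 4 * (9 * n ^ 2 - 120 * n + 192) := by
    rw [mul_sum, mul_sum, ← sum_sub_distrib,
      show 4 * (9 * n ^ 2 - 120 * n + 192) = ∑ v ∈ K, (9 * n ^ 2 - 120 * n + 192) by simp [hK],
      ← sum_add_distrib]
    exact sum_congr rfl fun v _ => by unfold excess; ring
  rw [← mul_sum] at hcs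
  rw [hsum]
  set s := ∑ v ∈ K, b v
  set q := ∑ v ∈ K, (2 * b v) ^ 2
  obtain rfl | hn18 : n = 17 ∨ 18 ≤ n := by omega
  · right
    refine ⟨rfl, ?_⟩
    nlinarith
  · left
    nlinarith [mul_nonneg (sub_nonneg.mpr hb) (sub_nonneg.mpr hn18), sq_nonneg (n - 4 - s)]

end Arithmetic

theorem PathSuspensionFree.cliqueFree_four {V : Type*} [Fintype V] [DecidableEq V]
    {G : SimpleGraph V} [DecidableRel G.Adj] (h : PathSuspensionFree G) {n : ℕ} (hn : 17 ≤ n)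
    (hV : Fintype.card V = n) (ht : n ^ 2 / 8 ≤ #(G.cliqueFinset 3)) : G.CliqueFree 4 := by
  intro K hK
  have hne : Nonempty V := Fintype.card_pos_iff.mp (by omega)
  obtain ⟨apex, hapex⟩ : ∃ apex : Finset V → V, ∀ T ∈ bookTriangles G, IsApex G T (apex T) := by
    have := fun T (hT : T ∈ bookTriangles G) => h.exists_isApex hT
    choose! apex hapex using this
    exact ⟨apex, hapex⟩
  have hn' : (17 : ℤ) ≤ n := by exact_mod_cast hn
  have hub := h.sum_excess_le hapex hV
  obtain ⟨hs, hs17⟩ := nine_mul_mul_sub_le ht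
  have hsub : ∀ S : Finset V, ∑ v ∈ S, excess n (apexDegree G apex v) (quadDegree G v) ≤
      ∑ v, excess n (apexDegree G apex v) (quadDegree G v) := fun S =>
    sum_le_sum_of_subset_of_nonneg (subset_univ S) fun v _ _ =>
      excess_nonneg hn' (Int.natCast_nonneg _) (Int.natCast_nonneg _)
  have hpos : ∀ L, G.IsNClique 4 L → ∀ v ∈ L, 1 ≤ quadDegree G v := fun L hL v hv =>
    card_pos.mpr ⟨L, by simp [hL, hv]⟩
  by_cases hone : ∀ v ∈ K, quadDegree G v = 1
  · have hb : ∑ v ∈ K, (apexDegree G apex v : ℤ) ≤ n - 4 := by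
      have h1 := h.sum_card_blockNeighbors_le hapex hK
      have h2 : ∑ v ∈ K, (apexDegree G apex v + 3) ≤ ∑ v ∈ K, #(blockNeighbors G apex v) :=
        sum_le_sum fun v hv => by
          have := h.apexDegree_add_quadDegree_le hapex v
          rwa [hone v hv] at this
      rw [sum_add_distrib, sum_const, hK.card_eq, smul_eq_mul] at h2
      have h3 : ∑ v ∈ K, apexDegree G apex v + 4 ≤ n := by omega
      zify at h3
      linarith
    have h4 := hsub K
    rw [sum_congr rfl (g := fun v => excess n (apexDegree G apex v) 1)
      fun v hv => by rw [hone v hv, Nat.cast_one]] at h4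
    rcases excess_sum_four hn' hK.card_eq hb with h5 | ⟨h17, h5⟩
    · linarith
    · linarith [hs17 (by exact_mod_cast h17)]
  · push Not at hone
    obtain ⟨v, hv, hv1⟩ := hone
    obtain ⟨L, hL, hLK⟩ : ∃ L ∈ {L ∈ G.cliqueFinset 4 | v ∈ L}, L ≠ K := by
      refine exists_mem_ne ?_ K
      have := hpos K hK v hv
      unfold quadDegree at this hv1
      omega
    simp only [mem_filter, SimpleGraph.mem_cliqueFinset_iff] at hL
    have hinter : #(K ∩ L) ≤ 1 := card_le_one.mpr fun a ha b hb => by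
      rw [mem_inter] at ha hb
      by_contra hab
      exact hLK (h.eq_of_two_mem hK hL.1 hab ha.1 hb.1 ha.2 hb.2).symm
    have hunion : 7 ≤ #(K ∪ L) := by
      have := card_union_add_card_inter K L
      rw [hK.card_eq, hL.1.card_eq] at this
      omega
    have hlow : ∀ c : ℤ, 0 ≤ c →
        (∀ v ∈ K ∪ L, c ≤ excess n (apexDegree G apex v) (quadDegree G v)) →
        7 * c ≤ 9 * n * (n ^ 2 - 8 * #(G.cliqueFinset 3)) := by
      intro c hc hcv
      have h1 := card_nsmul_le_sum _ _ _ hcv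
      rw [nsmul_eq_mul] at h1
      have h2 : (7 : ℤ) ≤ #(K ∪ L) := by exact_mod_cast hunion
      nlinarith [hsub (K ∪ L)]
    have hle : ∀ v ∈ K ∪ L, _ := fun v hv =>
      le_nine_mul_excess (n := n) (Int.natCast_nonneg (apexDegree G apex v))
        (show (1 : ℤ) ≤ quadDegree G v by
          rcases mem_union.mp hv with hv | hv
          · exact_mod_cast hpos K hK v hv
          · exact_mod_cast hpos L hL.1 v hv)
    obtain rfl | hn18 : n = 17 ∨ 18 ≤ n := by omega
    · have := hlow 23 (by norm_num) fun v hv => by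
        have := hle v hv
        push_cast at this ⊢
        omega
      linarith [hs17 rfl]
    · have := hlow (6 * n - 15) (by omega) fun v hv => by
        have := hle v hv
        omega
      omega

/-- For every `n ≥ 17`, an `n`-vertex `P̂₄`-free graph with at least `⌊n² / 8⌋`
triangles contains no `K₄` as a subgraph. -/
theorem stmt_17 (n : ℕ) (hn : 17 ≤ n) (G : SimpleGraph (Fin n))
    (hfree : ¬ Contains hatP4 G) (ht : n ^ 2 / 8 ≤ triangleCount G) :
    ¬ Contains (⊤ : SimpleGraph (Fin 4)) G := by
  classical
  rintro ⟨f, hf, hadj⟩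
  have hcount : triangleCount G = #(G.cliqueFinset 3) := by
    rw [triangleCount, ← SimpleGraph.coe_cliqueFinset, Set.ncard_coe_finset]
  rw [hcount] at ht
  refine (pathSuspensionFree_of_not_contains hfree).cliqueFree_four hn (Fintype.card_fin n) ht
    (univ.map ⟨f, hf⟩) ⟨?_, by simp⟩
  intro a ha b hb hab
  simp only [coe_map, Function.Embedding.coeFn_mk, coe_univ, Set.image_univ,
    Set.mem_range] at ha hb
  obtain ⟨i, rfl⟩ := ha
  obtain ⟨j, rfl⟩ := hb
  exact hadj fun hij => hab (congrArg f hij)
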